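/- Let I = I_a(F^b) be the generalized star configuration ideal. Then for all positive integers ℓ and m, one has the Harbourne–Huneke containment I^{(ℓ(h+m−1))} ⊆ 𝔪^{ℓ(h−1)} · (I^{(m)})^ℓ. -/

import Mathlib

open MvPolynomial

/-- The `N`-th symbolic power of an ideal `I`:
`I^{(N)} = ⋂_{p ∈ Ass(R/I)} (I^N R_p ∩ R)`, where `I^N R_p ∩ R` is the preimage in `R` of
the image of `I^N` under the localization map `R → R_p`. -/
noncomputable def symbolicPower {R : Type*} [CommRing R] (I : Ideal R) (N : ℕ) : Ideal R :=
  ⨅ (p : Ideal R) (hp : p ∈ associatedPrimes R (R ⧸ I)),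
    haveI : p.IsPrime := hp.isPrime
    Ideal.comap (algebraMap R (Localization.AtPrime p))
      (Ideal.map (algebraMap R (Localization.AtPrime p)) (I ^ N))

/-- The generalized star configuration ideal (uniform `a`-fold product ideal)
`I_a(F^b) = ⟨f₁^{n₁} ⋯ f_s^{n_s} : 0 ≤ nᵢ ≤ b, ∑ nᵢ = a⟩`. -/
noncomputable def afoldIdeal {R : Type*} [CommRing R] {s : ℕ} (f : Fin s → R) (a b : ℕ) :
    Ideal R :=
  Ideal.span {g | ∃ e : Fin s → ℕ, (∀ i, e i ≤ b) ∧ (∑ i, e i) = a ∧ g = ∏ i, f i ^ e i}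

/-- `g` is a nonzerodivisor modulo the ideal `J`. -/
def NzdMod {R : Type*} [CommRing R] (J : Ideal R) (g : R) : Prop :=
  ∀ x, g * x ∈ J → x ∈ J

section NzdMod

variable {R : Type*} [CommRing R]

theorem NzdMod.mul {J : Ideal R} {g g' : R} (hg : NzdMod J g) (hg' : NzdMod J g') :
    NzdMod J (g * g') := fun x hx => hg' x (hg _ (by rwa [← mul_assoc]))

theorem NzdMod.pow {J : Ideal R} {g : R} (hg : NzdMod J g) (k : ℕ) : NzdMod J (g ^ k) := by
  induction k with
  | zero => intro x hx; simpa using hx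
  | succ k ih => rw [pow_succ]; exact ih.mul hg

theorem NzdMod.top (g : R) : NzdMod (⊤ : Ideal R) g := fun _ _ => Submodule.mem_top

theorem mem_sup_span_singleton_iff {J : Ideal R} {g x : R} :
    x ∈ J ⊔ Ideal.span {g} ↔ ∃ r, x - g * r ∈ J := by
  rw [Submodule.mem_sup]
  constructor
  · rintro ⟨y, hy, z, hz, rfl⟩
    obtain ⟨r, rfl⟩ := Ideal.mem_span_singleton'.1 hz
    exact ⟨r, by rwa [mul_comm g, add_sub_cancel_right]⟩
  · rintro ⟨r, hr⟩
    exact ⟨_, hr, g * r, Ideal.mul_mem_right _ _ (Ideal.mem_span_singleton_self g), by ring⟩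

/-- Cancelling `g` from `(J, g ^ (k + 1))`, for `g` a nonzerodivisor modulo `J`. -/
theorem NzdMod.of_mul_mem_sup_pow_succ {J : Ideal R} {g x : R} (hg : NzdMod J g) {k : ℕ}
    (hx : g * x ∈ J ⊔ Ideal.span {g ^ (k + 1)}) : x ∈ J ⊔ Ideal.span {g ^ k} := by
  rw [mem_sup_span_singleton_iff] at hx ⊢
  obtain ⟨r, hr⟩ := hx
  refine ⟨r, hg _ ?_⟩
  convert hr using 1
  ring

/-- A nonzerodivisor modulo `(J, g)` is a nonzerodivisor modulo `(J, g ^ k)`. -/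
theorem NzdMod.sup_span_pow {J : Ideal R} {g t : R} (hg : NzdMod J g)
    (ht : NzdMod (J ⊔ Ideal.span {g}) t) (k : ℕ) : NzdMod (J ⊔ Ideal.span {g ^ k}) t := by
  induction k with
  | zero => simpa using NzdMod.top t
  | succ k ih =>
    intro x hx
    have hx' : t * x ∈ J ⊔ Ideal.span {g ^ k} := by
      rw [mem_sup_span_singleton_iff] at hx ⊢
      obtain ⟨r, hr⟩ := hx
      exact ⟨g * r, by convert hr using 1; ring⟩
    have hx₁ := ih x hx'
    rw [mem_sup_span_singleton_iff] at hx₁ hx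
    obtain ⟨y, hy⟩ := hx₁
    obtain ⟨r, hr⟩ := hx
    have hty : t * y - g * r ∈ J := by
      refine hg.pow k _ ?_
      have := J.sub_mem hr (J.mul_mem_left t hy)
      convert this using 1
      ring
    obtain ⟨w, hw⟩ := mem_sup_span_singleton_iff.1
      (ht y (mem_sup_span_singleton_iff.2 ⟨r, hty⟩))
    refine mem_sup_span_singleton_iff.2 ⟨w, ?_⟩
    have := J.add_mem hy (J.mul_mem_left (g ^ k) hw)
    convert this using 1
    ring

theorem mem_associatedPrimes_quotient_iff [IsNoetherianRing R] {J q : Ideal R} :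
    q ∈ associatedPrimes R (R ⧸ J) ↔ q.IsPrime ∧ ∃ z, ∀ r, r ∈ q ↔ r * z ∈ J := by
  rw [AssociatedPrimes.mem_iff, isAssociatedPrime_iff]
  refine and_congr_right fun _ => ?_
  constructor
  · rintro ⟨z, rfl⟩
    obtain ⟨z, rfl⟩ := Ideal.Quotient.mk_surjective z
    refine ⟨z, fun r => ?_⟩
    rw [Submodule.mem_colon_singleton, Submodule.mem_bot, ← Ideal.Quotient.eq_zero_iff_mem,
      map_mul]
    rfl
  · rintro ⟨z, hz⟩
    refine ⟨Ideal.Quotient.mk J z, ?_⟩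
    ext r
    rw [hz, Submodule.mem_colon_singleton, Submodule.mem_bot, ← Ideal.Quotient.eq_zero_iff_mem,
      map_mul]
    rfl

/-- Prime avoidance: an ideal contained in no associated prime of `R ⧸ J` contains a
nonzerodivisor modulo `J`. -/
theorem exists_nzdMod_of_not_le_associatedPrimes [IsNoetherianRing R] {J c : Ideal R}
    (hc : ∀ q ∈ associatedPrimes R (R ⧸ J), ¬ c ≤ q) : ∃ t ∈ c, NzdMod J t := by
  have havoid : ¬ ((c : Set R) ⊆ ⋃ q ∈ associatedPrimes R (R ⧸ J), (q : Set R)) := by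
    intro hsub
    obtain ⟨q, hq, hle⟩ := (c.subset_union_prime_finite (associatedPrimes.finite R (R ⧸ J))
      (f := id) ⊤ ⊤ fun _ h _ _ => h.isPrime).1 hsub
    exact hc q hq hle
  obtain ⟨t, htc, ht⟩ := Set.not_subset.1 havoid
  refine ⟨t, htc, fun x hx => ?_⟩
  rw [biUnion_associatedPrimes_eq_zero_divisors] at ht
  by_contra hxJ
  refine ht ⟨Ideal.Quotient.mk J x, fun h0 => hxJ (Ideal.Quotient.eq_zero_iff_mem.1 h0), ?_⟩
  exact Ideal.Quotient.eq_zero_iff_mem.2 hx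

/-- If `Q = J : μ` then the associated primes of `R ⧸ Q` are associated primes of `R ⧸ J`. -/
theorem associatedPrimes_quotient_colon_subset [IsNoetherianRing R] {J Q : Ideal R} {μ : R}
    (hQ : ∀ c, c * μ ∈ J ↔ c ∈ Q) :
    associatedPrimes R (R ⧸ Q) ⊆ associatedPrimes R (R ⧸ J) := by
  intro q hq
  rw [mem_associatedPrimes_quotient_iff] at hq ⊢
  obtain ⟨hp, z, hz⟩ := hq
  exact ⟨hp, z * μ, fun r => by rw [hz, ← hQ, mul_assoc]⟩

/-- Let `L` be a finite family of generators which, ordered by `key`, has colon ideals `Q`.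
If the ideal `𝔞` contains a regular sequence of length two modulo each `Q`, then
`𝔞` contains no zerodivisor ideal modulo `span (μ '' L)`. -/
theorem mem_span_of_linearQuotients {ι : Type*} [DecidableEq ι] (μ : ι → R) (key : ι → ℕ)
    (𝔞 : Ideal R) (h0 : ∃ g ∈ 𝔞, NzdMod (⊥ : Ideal R) g) (L : Finset ι) :
    (∀ e ∈ L, ∀ L' ⊆ L.erase e, (∀ v ∈ L, key v < key e → v ∈ L') →
      (∀ v ∈ L', key v ≤ key e) → μ e ∈ Ideal.span (μ '' L') ∨
        ∃ Q : Ideal R, (∀ c, c * μ e ∈ Ideal.span (μ '' L') ↔ c ∈ Q) ∧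
          ∃ g₁ ∈ 𝔞, ∃ g₂ ∈ 𝔞, NzdMod Q g₁ ∧ NzdMod (Q ⊔ Ideal.span {g₁}) g₂) →
    ∀ z, (∀ a ∈ 𝔞, a * z ∈ Ideal.span (μ '' L)) → z ∈ Ideal.span (μ '' L) := by
  induction L using Finset.induction_on_max_value key with
  | empty =>
    intro _ z hz
    obtain ⟨g, hg, hn⟩ := h0
    simpa using hn z (by simpa using hz g hg)
  | insert e L he hmax ih =>
    intro H z hz
    have ih' := ih (by
      intro v hv L' hL' hlt hle
      refine H v (Finset.mem_insert_of_mem hv) L' ?_ ?_ hle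
      · exact hL'.trans (Finset.erase_subset_erase _ (Finset.subset_insert _ _))
      · intro v' hv' hlt'
        rcases Finset.mem_insert.1 hv' with rfl | h
        · exact absurd (hmax v hv) (not_le.2 hlt')
        · exact hlt v' h hlt')
    have hstep := H e (Finset.mem_insert_self e L) L (by rw [Finset.erase_insert he])
      (fun v hv hlt => (Finset.mem_insert.1 hv).resolve_left (by rintro rfl; exact lt_irrefl _ hlt))
      hmax
    rw [Finset.coe_insert, Set.image_insert_eq, Ideal.span_insert, sup_comm] at hz ⊢
    rcases hstep with hmem | ⟨Q, hQ, g₁, hg₁, g₂, hg₂, hn₁, hn₂⟩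
    · rw [sup_eq_left.2 ((Ideal.span_singleton_le_iff_mem _).2 hmem)] at hz ⊢
      exact ih' z hz
    · set M := Ideal.span (μ '' (L : Set ι))
      have hz' : ∀ a ∈ 𝔞, ∃ c, a * z - μ e * c ∈ M := fun a ha =>
        mem_sup_span_singleton_iff.1 (hz a ha)
      have hcross : ∀ a b c c', a * z - μ e * c ∈ M → b * z - μ e * c' ∈ M →
          b * c - a * c' ∈ Q := by
        intro a b c c' h1 h2
        rw [← hQ]
        have := M.sub_mem (M.mul_mem_left a h2) (M.mul_mem_left b h1)
        convert this using 1
        ring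
      obtain ⟨c₁, hc₁⟩ := hz' g₁ hg₁
      obtain ⟨c₂, hc₂⟩ := hz' g₂ hg₂
      obtain ⟨w, hw⟩ := mem_sup_span_singleton_iff.1 (hn₂ c₁
        (mem_sup_span_singleton_iff.2 ⟨c₂, hcross _ _ _ _ hc₁ hc₂⟩))
      refine mem_sup_span_singleton_iff.2 ⟨w, ih' _ fun a ha => ?_⟩
      obtain ⟨c, hc⟩ := hz' a ha
      have hcw : c - a * w ∈ Q := by
        refine hn₁ _ ?_
        have := Q.add_mem (hcross _ _ _ _ hc hc₁) (Q.mul_mem_left a hw)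
        convert this using 1
        ring
      have := M.add_mem hc ((hQ _).2 hcw)
      convert this using 1
      ring

end NzdMod

/-- The family `f` is `h`-generic: modulo any `k ≤ h` of its members, every other member is a
nonzerodivisor. -/
def IsHGeneric {R ι : Type*} [CommRing R] (f : ι → R) (h : ℕ) : Prop :=
  ∀ (A : Finset ι) (j : ι), A.card ≤ h → j ∉ A → NzdMod (Ideal.span (f '' A)) (f j)

/-- The ideal generated by the powers `f i ^ n i` for `i ∈ A`. -/
def powSpan {R ι : Type*} [CommRing R] (f : ι → R) (A : Finset ι) (n : ι → ℕ) : Ideal R :=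
  Ideal.span ((fun i => f i ^ n i) '' (A : Set ι))

section Generic

variable {R ι : Type*} [CommRing R] {f : ι → R} {h : ℕ}

theorem powSpan_congr (f : ι → R) {A : Finset ι} {n n' : ι → ℕ} (hn : ∀ i ∈ A, n i = n' i) :
    powSpan f A n = powSpan f A n' := by
  unfold powSpan
  congr 1
  exact Set.image_congr fun i hi => by rw [hn i hi]

theorem powSpan_eq_span (f : ι → R) {A : Finset ι} {n : ι → ℕ} (hn : ∀ i ∈ A, n i = 1) :
    powSpan f A n = Ideal.span (f '' A) := by
  unfold powSpan
  congr 1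
  exact Set.image_congr fun i hi => by rw [hn i hi, pow_one]

theorem powSpan_eq_top (f : ι → R) {A : Finset ι} {n : ι → ℕ} {k : ι} (hk : k ∈ A)
    (hn : n k = 0) : powSpan f A n = ⊤ :=
  (Ideal.eq_top_iff_one _).2 (Ideal.subset_span ⟨k, hk, by simp [hn]⟩)

variable [DecidableEq ι]

theorem powSpan_insert (f : ι → R) (A : Finset ι) (n : ι → ℕ) (k : ι) :
    powSpan f (insert k A) n = powSpan f A n ⊔ Ideal.span {f k ^ n k} := by
  rw [powSpan, powSpan, Finset.coe_insert, Set.image_insert_eq, Ideal.span_insert, sup_comm]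

theorem IsHGeneric.nzdMod_powSpan (hf : IsHGeneric f h) {A : Finset ι} (n : ι → ℕ)
    (hA : A.card ≤ h) {j : ι} (hj : j ∉ A) : NzdMod (powSpan f A n) (f j) := by
  induction hN : ∑ i ∈ A, n i using Nat.strong_induction_on generalizing A n j with
  | _ N IH =>
  by_cases h0 : ∃ k ∈ A, n k = 0
  · obtain ⟨k, hk, hk0⟩ := h0
    rw [powSpan_eq_top f hk hk0]
    exact NzdMod.top _
  push Not at h0
  by_cases h2 : ∃ k ∈ A, n k ≠ 1
  · obtain ⟨k, hk, hk1⟩ := h2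
    obtain ⟨m, hm⟩ : ∃ m, n k = m + 2 := ⟨n k - 2, by have := h0 k hk; omega⟩
    have hjk : j ≠ k := fun hjk => hj (hjk ▸ hk)
    have hkA : k ∉ A.erase k := Finset.notMem_erase k A
    have hjA : j ∉ A.erase k := fun hj' => hj (Finset.mem_of_mem_erase hj')
    have hcard : (A.erase k).card ≤ h := (Finset.card_le_card (Finset.erase_subset k A)).trans hA
    have hsum : ∑ i ∈ A.erase k, n i + n k = ∑ i ∈ A, n i := Finset.sum_erase_add A n hk
    have hupd : ∀ c, ∑ i ∈ A, Function.update n k c i = ∑ i ∈ A.erase k, n i + c := by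
      intro c
      rw [← Finset.sum_erase_add A _ hk, Function.update_self]
      congr 1
      exact Finset.sum_congr rfl fun i hi =>
        Function.update_of_ne (Finset.ne_of_mem_erase hi) _ _
    have hpow : ∀ c, powSpan f A (Function.update n k c) =
        powSpan f (A.erase k) n ⊔ Ideal.span {f k ^ c} := by
      intro c
      conv_lhs => rw [← Finset.insert_erase hk]
      rw [powSpan_insert, Function.update_self,
        powSpan_congr f fun i hi => Function.update_of_ne (Finset.ne_of_mem_erase hi) _ _]
    have hkn : NzdMod (powSpan f (A.erase k) n) (f k) := IH _ (by omega) n hcard hkA rfl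
    have hj1 : NzdMod (powSpan f (A.erase k) n ⊔ Ideal.span {f k}) (f j) := by
      have := IH _ (by rw [hupd 1]; omega) (Function.update n k 1) hA hj rfl
      rwa [hpow, pow_one] at this
    rw [← Function.update_eq_self k n, hpow]
    exact hkn.sup_span_pow hj1 _
  · push Not at h2
    rw [powSpan_eq_span f h2]
    exact hf A j hA hj

theorem IsHGeneric.mem_powSpan_of_mul_mem (hf : IsHGeneric f h) {A : Finset ι} {n : ι → ℕ}
    (hA : A.card ≤ h) {k : ι} {x : R} (hx : f k * x ∈ powSpan f A n) :
    x ∈ powSpan f A (Function.update n k (n k - 1)) := by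
  by_cases hk : k ∈ A
  · rcases Nat.eq_zero_or_pos (n k) with h0 | hpos
    · rw [powSpan_eq_top f hk (by simp [h0])]
      exact Submodule.mem_top
    · have hkn : NzdMod (powSpan f (A.erase k) n) (f k) :=
        hf.nzdMod_powSpan n ((Finset.card_le_card (Finset.erase_subset k A)).trans hA)
          (Finset.notMem_erase k A)
      rw [← Finset.insert_erase hk, powSpan_insert] at hx ⊢
      rw [Function.update_self,
        powSpan_congr f fun i hi => Function.update_of_ne (Finset.ne_of_mem_erase hi) _ _]
      refine hkn.of_mul_mem_sup_pow_succ ?_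
      rwa [Nat.sub_add_cancel hpos]
  · rw [powSpan_congr f fun i hi => Function.update_of_ne (ne_of_mem_of_not_mem hi hk) _ _]
    exact hf.nzdMod_powSpan n hA hk x hx

theorem IsHGeneric.mem_powSpan_of_pow_mul_mem (hf : IsHGeneric f h) {A : Finset ι} {n : ι → ℕ}
    (hA : A.card ≤ h) {k : ι} (a : ℕ) {x : R} (hx : f k ^ a * x ∈ powSpan f A n) :
    x ∈ powSpan f A (Function.update n k (n k - a)) := by
  induction a generalizing n with
  | zero => simpa using hx
  | succ a ih =>
    rw [pow_succ', mul_assoc] at hx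
    have := ih (hf.mem_powSpan_of_mul_mem hA hx)
    rwa [Function.update_idem, Function.update_self, Nat.sub_sub, add_comm 1 a] at this

/-- Colon ideals of pure power ideals by monomials in an `h`-generic family. -/
theorem IsHGeneric.mem_powSpan_of_prod_mul_mem (hf : IsHGeneric f h) {A : Finset ι}
    {n : ι → ℕ} (hA : A.card ≤ h) (S : Finset ι) (e : ι → ℕ) {x : R}
    (hx : (∏ i ∈ S, f i ^ e i) * x ∈ powSpan f A n) :
    x ∈ powSpan f A (fun i => n i - if i ∈ S then e i else 0) := by
  induction S using Finset.induction_on generalizing n with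
  | empty => simpa using hx
  | insert k S hk ih =>
    rw [Finset.prod_insert hk, mul_assoc] at hx
    have := ih (hf.mem_powSpan_of_pow_mul_mem hA _ hx)
    convert this using 2
    ext i
    by_cases hik : i = k
    · subst hik; simp [hk]
    · simp [hik]

/-- Suppose every exponent vector in `V` exceeds `e` at some index in `P`. Then an element
carrying the monomial of `e` into the ideal of monomials from `V` lies in `⟨f i : i ∈ P⟩`. -/
theorem IsHGeneric.mem_span_of_mul_prod_mem (hf : IsHGeneric f h) {C P : Finset ι} (hPC : P ⊆ C)
    (hP : P.card ≤ h) {V : Set (ι → ℕ)} {e : ι → ℕ}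
    (hV : ∀ v ∈ V, ∃ j ∈ P, e j < v j) {c : R}
    (hc : c * ∏ i ∈ C, f i ^ e i ∈ Ideal.span ((fun v => ∏ i ∈ C, f i ^ v i) '' V)) :
    c ∈ Ideal.span (f '' P) := by
  have hle : Ideal.span ((fun v => ∏ i ∈ C, f i ^ v i) '' V) ≤ powSpan f P (fun i => e i + 1) := by
    rw [Ideal.span_le]
    rintro _ ⟨v, hv, rfl⟩
    obtain ⟨j, hj, hlt⟩ := hV v hv
    refine Ideal.mem_of_dvd _ ?_ (Ideal.subset_span ⟨j, hj, rfl⟩)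
    exact (pow_dvd_pow (f j) hlt).trans (Finset.dvd_prod_of_mem (fun i => f i ^ v i) (hPC hj))
  rw [mul_comm] at hc
  have := hf.mem_powSpan_of_prod_mul_mem hP C e (hle hc)
  rwa [powSpan_eq_span] at this
  intro i hi
  simp [hPC hi]

theorem IsHGeneric.nzdMod_sup_pow (hf : IsHGeneric f h) {P : Finset ι} (hP : P.card + 1 ≤ h)
    {j k : ι} (hj : j ∉ P) (hk : k ∉ P) (hjk : j ≠ k) (a b : ℕ) :
    NzdMod (Ideal.span (f '' P) ⊔ Ideal.span {f j ^ a}) (f k ^ b) := by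
  have := hf.nzdMod_powSpan (A := insert j P) (fun i => if i = j then a else 1)
    (by rwa [Finset.card_insert_of_notMem hj]) (j := k) (by simp [hk, hjk.symm])
  rw [powSpan_insert, powSpan_eq_span, if_pos rfl] at this
  · exact this.pow b
  · intro i hi
    rw [if_neg (ne_of_mem_of_not_mem hi hj)]

end Generic

/-- Exponent vectors `e` for which the total defect `∑ (T - e i)` (truncated subtraction) over any
at most `h` indices of `C` is at most `D`. -/
def starExp {ι : Type*} (h T D : ℕ) (C : Finset ι) : Set (ι → ℕ) :=
  {e | ∀ B ⊆ C, B.card ≤ h → ∑ i ∈ B, (T - e i) ≤ D}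

section StarExp

variable {ι : Type*} {h T D : ℕ} {C : Finset ι}

theorem starExp_mono {e e' : ι → ℕ} (he : e ∈ starExp h T D C) (hle : ∀ i ∈ C, e i ≤ e' i) :
    e' ∈ starExp h T D C := fun B hB hc =>
  (Finset.sum_le_sum fun i hi => Nat.sub_le_sub_left (hle i (hB hi)) T).trans (he B hB hc)

theorem starExp_add {T' D' : ℕ} {e e' : ι → ℕ} (he : e ∈ starExp h T D C)
    (he' : e' ∈ starExp h T' D' C) : e + e' ∈ starExp h (T + T') (D + D') C := fun B hB hc =>
  calc ∑ i ∈ B, (T + T' - (e + e') i) ≤ ∑ i ∈ B, ((T - e i) + (T' - e' i)) :=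
        Finset.sum_le_sum fun i _ => by simp only [Pi.add_apply]; omega
    _ ≤ D + D' := by
        rw [Finset.sum_add_distrib]
        exact Nat.add_le_add (he B hB hc) (he' B hB hc)

theorem mem_starExp_of_sum_le [Fintype ι] {e : ι → ℕ} (he : ∑ i, (T - e i) ≤ D) :
    e ∈ starExp h T D C := fun B _ _ =>
  (Finset.sum_le_sum_of_subset (Finset.subset_univ B)).trans he

variable [DecidableEq ι]

theorem sum_update_add (g : ι → ℕ → ℕ) (e : ι → ℕ) {B : Finset ι} {k : ι} (hk : k ∈ B) (c : ℕ) :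
    ∑ i ∈ B, g i (Function.update e k c i) + g k (e k) = ∑ i ∈ B, g i (e i) + g k c := by
  rw [← Finset.sum_erase_add B _ hk, ← Finset.sum_erase_add B (fun i => g i (e i)) hk,
    Function.update_self, Finset.sum_congr rfl fun i hi =>
      congrArg (g i) (Function.update_of_ne (Finset.ne_of_mem_erase hi) _ _)]
  omega

/-- Move one unit of the exponent vector `v` from index `i` to index `j`. -/
def moveUnit (v : ι → ℕ) (i j : ι) : ι → ℕ :=
  Function.update (Function.update v i (v i - 1)) j (v j + 1)

theorem moveUnit_target (v : ι → ℕ) (i j : ι) : moveUnit v i j j = v j + 1 := by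
  simp [moveUnit]

theorem moveUnit_source (v : ι → ℕ) {i j : ι} (hij : i ≠ j) : moveUnit v i j i = v i - 1 := by
  simp [moveUnit, hij]

theorem moveUnit_of_ne (v : ι → ℕ) {i j k : ι} (hi : k ≠ i) (hj : k ≠ j) :
    moveUnit v i j k = v k := by
  simp [moveUnit, hi, hj]

theorem sum_moveUnit_add (g : ι → ℕ → ℕ) (v : ι → ℕ) {B : Finset ι} {i j : ι} (hi : i ∈ B)
    (hj : j ∈ B) (hij : i ≠ j) :
    ∑ k ∈ B, g k (moveUnit v i j k) + g j (v j) + g i (v i) =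
      ∑ k ∈ B, g k (v k) + g j (v j + 1) + g i (v i - 1) := by
  have h1 := sum_update_add g v hi (v i - 1)
  have h2 := sum_update_add g (Function.update v i (v i - 1)) hj (v j + 1)
  rw [Function.update_of_ne hij.symm] at h2
  simp only [moveUnit]
  omega

theorem moveUnit_mem_starExp {v : ι → ℕ} (hv : v ∈ starExp h T D C) {i j : ι} (hj : j ∈ C)
    (hlt : v j < v i) : moveUnit v i j ∈ starExp h T D C := by
  intro B hB hc
  have hij : i ≠ j := by rintro rfl; exact lt_irrefl _ hlt
  by_cases hiB : i ∈ B
  · by_cases hjB : j ∈ B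
    · have h1 := sum_moveUnit_add (fun _ x => T - x) v hiB hjB hij
      have h2 := hv B hB hc
      omega
    · have hj' : j ∉ B.erase i := fun hj' => hjB (Finset.mem_of_mem_erase hj')
      have hcard : (insert j (B.erase i)).card = B.card := by
        rw [Finset.card_insert_of_notMem hj', Finset.card_erase_add_one hiB]
      have h1 := hv (insert j (B.erase i))
        (Finset.insert_subset hj ((Finset.erase_subset i B).trans hB)) (hcard.trans_le hc)
      rw [Finset.sum_insert hj'] at h1
      rw [← Finset.sum_erase_add B _ hiB, moveUnit_source v hij,
        Finset.sum_congr rfl fun k hk => congrArg (T - ·) (moveUnit_of_ne v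
          (Finset.ne_of_mem_erase hk) (ne_of_mem_of_not_mem hk hj'))]
      omega
  · refine (Finset.sum_le_sum fun k hk => ?_).trans (hv B hB hc)
    have hki : k ≠ i := ne_of_mem_of_not_mem hk hiB
    by_cases hkj : k = j
    · subst hkj; rw [moveUnit_target]; omega
    · rw [moveUnit_of_ne v hki hkj]

/-- If `e` is almost constant on the indices where `v` exceeds `e`, then moving units makes
`v` lie below `e`. -/
theorem exists_le_mem_starExp {e v : ι → ℕ} (hv : v ∈ starExp h T D C)
    (hsum : ∑ i ∈ C, v i ≤ ∑ i ∈ C, e i)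
    (hflat : ∀ i ∈ C, e i < v i → ∀ j ∈ C, e j ≤ e i + 1) :
    ∃ v' ∈ starExp h T D C, (∀ i ∈ C, v' i ≤ e i) ∧ ∑ i ∈ C, v' i = ∑ i ∈ C, v i := by
  induction hN : ∑ i ∈ C, (v i - e i) using Nat.strong_induction_on generalizing v with
  | _ N IH =>
  by_cases hle : ∀ i ∈ C, v i ≤ e i
  · exact ⟨v, hv, hle, rfl⟩
  push Not at hle
  obtain ⟨i, hi, hlt⟩ := hle
  obtain ⟨j, hj, hjlt⟩ : ∃ j ∈ C, v j < e j := by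
    by_contra! hcon
    exact absurd (Finset.sum_lt_sum hcon ⟨i, hi, hlt⟩) (not_lt.2 hsum)
  have hmove := hflat i hi hlt j hj
  have hij : i ≠ j := by rintro rfl; omega
  have hs := sum_moveUnit_add (fun _ x => x) v hi hj hij
  have hd := sum_moveUnit_add (fun k x => x - e k) v hi hj hij
  obtain ⟨v', hv', hle', hsum'⟩ := IH _ (by omega) (moveUnit_mem_starExp hv hj
    (show v j < v i by omega)) (by omega) (by
      intro k hk hek
      refine hflat k hk ?_
      by_cases hkj : k = j
      · subst hkj; rw [moveUnit_target] at hek; omega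
      · by_cases hki : k = i
        · subst hki; exact hlt
        · rwa [moveUnit_of_ne v hki hkj] at hek) rfl
  exact ⟨v', hv', hle', by omega⟩

theorem card_lt_of_minimal {e : ι → ℕ} (hh : 0 < h) (he : e ∈ starExp h T D C)
    (hmin : ∀ i ∈ C, 0 < e i → Function.update e i (e i - 1) ∉ starExp h T D C)
    {i : ι} (hi : i ∈ C) : (C.filter fun j => e j < e i).card < h := by
  rcases Nat.eq_zero_or_pos (e i) with h0 | hpos
  · simpa [h0] using hh
  by_contra! hcard
  refine hmin i hi hpos fun B hB hc => ?_
  by_cases hiB : i ∈ B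
  · have hlt : (B.erase i).card < (C.filter fun j => e j < e i).card := by
      have := Finset.card_erase_lt_of_mem hiB
      omega
    obtain ⟨j, hj, hjB⟩ := Finset.exists_mem_notMem_of_card_lt_card hlt
    rw [Finset.mem_filter] at hj
    have h1 := he (insert j (B.erase i))
      (Finset.insert_subset hj.1 ((Finset.erase_subset i B).trans hB))
      (by rwa [Finset.card_insert_of_notMem hjB, Finset.card_erase_add_one hiB])
    rw [Finset.sum_insert hjB] at h1
    have h2 := sum_update_add (fun _ x => T - x) e hiB (e i - 1)
    have h3 := Finset.sum_erase_add B (fun k => T - e k) hiB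
    omega
  · rw [Finset.sum_congr rfl fun k hk => congrArg (T - ·)
      (Function.update_of_ne (ne_of_mem_of_not_mem hk hiB) _ _)]
    exact he B hB hc

end StarExp

section Ordering

variable {s h T D : ℕ} {C : Finset (Fin s)}

/-- A strictly convex cost of the exponent `x` at the index `i`. -/
def exponentCost (i : Fin s) (x : ℕ) : ℕ := ∑ y ∈ Finset.range x, (s * (y + 1) + i)

theorem exponentCost_succ (i : Fin s) (x : ℕ) :
    exponentCost i (x + 1) = exponentCost i x + (s * (x + 1) + i) :=
  Finset.sum_range_succ _ _

theorem le_exponentCost_add {i : Fin s} {x c : ℕ} (hc : c ≤ s * (x + 1) + i) (t : ℕ) :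
    exponentCost i x + c * t ≤ exponentCost i (x + t) := by
  induction t with
  | zero => simp
  | succ t ih =>
    rw [← add_assoc, exponentCost_succ, mul_add, mul_one]
    have : s * (x + 1) ≤ s * (x + t + 1) := Nat.mul_le_mul_left _ (by omega)
    omega

theorem exponentCost_add_le {i : Fin s} {x c t : ℕ} (hc : s * (x + t) + i ≤ c) :
    exponentCost i (x + t) ≤ exponentCost i x + c * t := by
  induction t with
  | zero => simp
  | succ t ih =>
    have : s * (x + t) ≤ s * (x + (t + 1)) := Nat.mul_le_mul_left _ (by omega)
    have h2 := ih (by omega)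
    have h3 : c * (t + 1) = c * t + c := Nat.mul_succ c t
    rw [← add_assoc, exponentCost_succ]
    rw [← add_assoc] at hc
    omega

/-- The total cost of an exponent vector on the index set `C`. -/
def starKey (C : Finset (Fin s)) (e : Fin s → ℕ) : ℕ := ∑ i ∈ C, exponentCost i (e i)

theorem starKey_update_lt {e : Fin s → ℕ} {i : Fin s} (hi : i ∈ C) (hpos : 0 < e i) :
    starKey C (Function.update e i (e i - 1)) < starKey C e := by
  have h1 := sum_update_add (fun i x => exponentCost i x) e hi (e i - 1)
  obtain ⟨x, hx⟩ : ∃ x, e i = x + 1 := ⟨e i - 1, by omega⟩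
  have h2 := exponentCost_succ i x
  have h3 : 0 < s * (x + 1) := Nat.mul_pos i.pos (by omega)
  simp only [hx, Nat.add_sub_cancel] at h1 ⊢
  unfold starKey
  omega

theorem starKey_moveUnit_lt {e : Fin s → ℕ} {i j : Fin s} (hi : i ∈ C) (hj : j ∈ C)
    (hlt : s * (e j + 1) + j < s * e i + i) :
    e j < e i ∧ starKey C (moveUnit e i j) < starKey C e := by
  have hji : e j < e i := by
    by_contra! hle
    have : s * (e i + 1) ≤ s * (e j + 1) := Nat.mul_le_mul_left _ (by omega)
    have := i.isLt
    rw [mul_add s (e i)] at *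
    omega
  refine ⟨hji, ?_⟩
  have hij : i ≠ j := by rintro rfl; exact lt_irrefl _ hji
  have h1 := sum_moveUnit_add (fun i x => exponentCost i x) e hi hj hij
  obtain ⟨x, hx⟩ : ∃ x, e i = x + 1 := ⟨e i - 1, by omega⟩
  have h2 := exponentCost_succ i x
  have h3 := exponentCost_succ j (e j)
  simp only [hx, Nat.add_sub_cancel] at h1 h2 h3 hlt
  unfold starKey
  omega

/-- Linear quotients: the indices `P` generating the colon ideal at a minimal exponent vector
`e`, when exponent vectors are ordered by `starKey`. -/
theorem exists_linearQuotient_indices {e : Fin s → ℕ} (hh : 0 < h) (hC : C.Nonempty)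
    (he : e ∈ starExp h T D C)
    (hmin : ∀ i ∈ C, 0 < e i → Function.update e i (e i - 1) ∉ starExp h T D C) :
    ∃ P ⊂ C, P.card < h ∧
      (∀ j ∈ P, ∃ i ∈ C, e j < e i ∧ starKey C (moveUnit e i j) < starKey C e) ∧
      ∀ v ∈ starExp h T D C, (∃ i ∈ C, v i ≠ e i) → starKey C v ≤ starKey C e →
        ∃ j ∈ P, e j < v j := by
  obtain ⟨m, hm, hmax⟩ := Finset.exists_max_image C (fun i => s * e i + i) hC
  have hmin' : ∀ v ∈ starExp h T D C, (∀ i ∈ C, v i ≤ e i) → ∀ i ∈ C, v i = e i := by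
    intro v hv hle i hi
    by_contra hne
    have hlt := lt_of_le_of_ne (hle i hi) hne
    refine hmin i hi (by omega) (starExp_mono hv fun k hk => ?_)
    by_cases hki : k = i
    · subst hki; rw [Function.update_self]; omega
    · rw [Function.update_of_ne hki]; exact hle k hk
  refine ⟨C.filter fun j => s * (e j + 1) + j < s * e m + m, ?_, ?_, ?_, ?_⟩
  · refine Finset.filter_ssubset.2 ⟨m, hm, ?_⟩
    rw [mul_add]
    omega
  · refine (Finset.card_le_card fun j hj => ?_).trans_lt (card_lt_of_minimal hh he hmin hm)
    rw [Finset.mem_filter] at hj ⊢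
    exact ⟨hj.1, (starKey_moveUnit_lt hm hj.1 hj.2).1⟩
  · intro j hj
    rw [Finset.mem_filter] at hj
    exact ⟨m, hm, starKey_moveUnit_lt hm hj.1 hj.2⟩
  · intro v hv ⟨i₀, hi₀, hne⟩ hkey
    by_contra! hP
    have hbig : ∀ i ∈ C, e i < v i → s * e m + m ≤ s * (e i + 1) + i := by
      intro i hi hlt
      by_contra! hcon
      exact absurd (hP i (Finset.mem_filter.2 ⟨hi, hcon⟩)) (not_le.2 hlt)
    rcases le_or_gt (∑ i ∈ C, e i) (∑ i ∈ C, v i) with hsum | hsum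
    · by_cases hex : ∃ i ∈ C, e i < v i
      · obtain ⟨i, hi, hlt⟩ := hex
        have hup : ∀ i ∈ C, e i < v i →
            exponentCost i (e i) + (s * e m + m) * (v i - e i) < exponentCost i (v i) := by
          intro i hi hlt
          have hstrict : s * e m + m + 1 ≤ s * (e i + 1) + i := by
            refine lt_of_le_of_ne (hbig i hi hlt) fun heq => ?_
            have hmod : (m : ℕ) = i := by
              have := congrArg (· % s) heq
              simpa [Nat.mod_eq_of_lt m.isLt, Nat.mod_eq_of_lt i.isLt, Nat.mul_add_mod] using this
            obtain rfl := Fin.ext hmod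
            rw [mul_add] at heq
            have := m.pos
            omega
          have := le_exponentCost_add hstrict (v i - e i)
          rw [Nat.add_sub_cancel' hlt.le, add_mul, one_mul] at this
          omega
        have hterm : ∀ i ∈ C, (exponentCost i (e i) : ℤ) +
            (s * e m + m : ℕ) * ((v i : ℤ) - e i) ≤ exponentCost i (v i) := by
          intro i hi
          rcases lt_or_ge (e i) (v i) with h1 | h1
          · have := hup i hi h1
            rw [← Nat.cast_sub h1.le]
            exact_mod_cast this.le
          · have := exponentCost_add_le (i := i) (x := v i) (t := e i - v i)
              (c := s * e m + m) (by rw [Nat.add_sub_cancel' h1]; exact hmax i hi)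
            rw [Nat.add_sub_cancel' h1] at this
            have h2 : (exponentCost i (e i) : ℤ) ≤ exponentCost i (v i) +
              (s * e m + m : ℕ) * ((e i : ℤ) - v i) := by
              rw [← Nat.cast_sub h1]; exact_mod_cast this
            linarith
        have hlt' := Finset.sum_lt_sum hterm ⟨i, hi, by
          have := hup i hi hlt
          rw [← Nat.cast_sub hlt.le]
          exact_mod_cast this⟩
        rw [Finset.sum_add_distrib, ← Finset.mul_sum, Finset.sum_sub_distrib] at hlt'
        have h1 : (starKey C v : ℤ) ≤ starKey C e := by exact_mod_cast hkey
        have h2 : (∑ i ∈ C, (e i : ℤ)) ≤ ∑ i ∈ C, (v i : ℤ) := by exact_mod_cast hsum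
        simp only [starKey, Nat.cast_sum] at h1
        have h3 : (0 : ℤ) ≤ (s * e m + m : ℕ) * (∑ i ∈ C, (v i : ℤ) - ∑ i ∈ C, (e i : ℤ)) :=
          mul_nonneg (by positivity) (by linarith)
        linarith
      · push Not at hex
        exact hne (hmin' v hv hex i₀ hi₀)
    · obtain ⟨v', hv', hle', hsum'⟩ := exists_le_mem_starExp hv hsum.le (by
        intro i hi hlt j hj
        have h1 := hbig i hi hlt
        have h2 := hmax j hj
        by_contra! hcon
        have h3 : s * (e i + 2) ≤ s * e j := Nat.mul_le_mul_left _ (by omega)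
        rw [mul_add] at h1 h3
        have := i.isLt
        omega)
      have h4 : ∑ i ∈ C, v' i = ∑ i ∈ C, e i := Finset.sum_congr rfl (hmin' v' hv' hle')
      omega

end Ordering

/-- The ideal generated by the monomials in `f` on the index set `C` with exponent vectors in
`starExp h T D C`. -/
def starSpan {R : Type*} [CommRing R] {s : ℕ} (f : Fin s → R) (h T D : ℕ)
    (C : Finset (Fin s)) : Ideal R :=
  Ideal.span ((fun e => ∏ i ∈ C, f i ^ e i) '' starExp h T D C)

open Classical in
/-- The exponent vectors of `starExp h T D C` supported on `C` and bounded by `T`. -/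
noncomputable def starBox {s : ℕ} (h T D : ℕ) (C : Finset (Fin s)) : Finset (Fin s → ℕ) :=
  (Fintype.piFinset fun i => if i ∈ C then Finset.range (T + 1) else {0}).filter
    (· ∈ starExp h T D C)

section StarSpan

variable {R : Type*} [CommRing R] {s h T D : ℕ} {f : Fin s → R} {C : Finset (Fin s)}

theorem mem_starBox {e : Fin s → ℕ} : e ∈ starBox h T D C ↔
    (∀ i ∈ C, e i ≤ T) ∧ (∀ i ∉ C, e i = 0) ∧ e ∈ starExp h T D C := by
  simp only [starBox, Finset.mem_filter, Fintype.mem_piFinset, ← and_assoc]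
  refine and_congr_left fun _ => ⟨fun H => ⟨fun i hi => ?_, fun i hi => ?_⟩, fun H i => ?_⟩
  · have := H i
    rw [if_pos hi, Finset.mem_range] at this
    omega
  · have := H i
    rwa [if_neg hi, Finset.mem_singleton] at this
  · by_cases hi : i ∈ C
    · rw [if_pos hi, Finset.mem_range]
      have := H.1 i hi
      omega
    · rw [if_neg hi, Finset.mem_singleton]
      exact H.2 i hi

theorem starSpan_eq_span_starBox (f : Fin s → R) (h T D : ℕ) (C : Finset (Fin s)) :
    starSpan f h T D C = Ideal.span
      ((fun e : Fin s → ℕ => ∏ i ∈ C, f i ^ e i) '' (starBox h T D C : Set (Fin s → ℕ))) := by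
  refine le_antisymm (Ideal.span_le.2 ?_)
    (Ideal.span_mono (Set.image_mono fun e he => (mem_starBox.1 he).2.2))
  rintro _ ⟨e, he, rfl⟩
  refine Ideal.mem_of_dvd _ (a := ∏ i ∈ C, f i ^ (if i ∈ C then min (e i) T else 0)) ?_
    (Ideal.subset_span ⟨_, mem_starBox.2 ⟨fun i hi => ?_, fun i hi => ?_, fun B hB hc => ?_⟩, rfl⟩)
  · refine Finset.prod_dvd_prod_of_dvd _ _ fun i hi => pow_dvd_pow _ ?_
    rw [if_pos hi]
    exact min_le_left _ _
  · rw [if_pos hi]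
    exact min_le_right _ _
  · rw [if_neg hi]
  · refine (Finset.sum_le_sum fun i hi => ?_).trans (he B hB hc)
    rw [if_pos (hB hi)]
    omega

theorem mul_prod_moveUnit {ι : Type*} [DecidableEq ι] (f : ι → R) (e : ι → ℕ) {C : Finset ι}
    {i j : ι} (hi : i ∈ C) (hj : j ∈ C) (hij : i ≠ j) (hpos : 0 < e i) :
    f i * ∏ k ∈ C, f k ^ moveUnit e i j k = f j * ∏ k ∈ C, f k ^ e k := by
  have hj' : j ∈ C.erase i := Finset.mem_erase.2 ⟨hij.symm, hj⟩
  rw [← Finset.mul_prod_erase C _ hi, ← Finset.mul_prod_erase _ _ hj',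
    ← Finset.mul_prod_erase C (fun k => f k ^ e k) hi,
    ← Finset.mul_prod_erase _ (fun k => f k ^ e k) hj',
    moveUnit_source e hij, moveUnit_target, Finset.prod_congr rfl fun k hk =>
      congrArg (f k ^ ·) (moveUnit_of_ne e (Finset.ne_of_mem_erase (Finset.mem_of_mem_erase hk))
        (Finset.ne_of_mem_erase hk))]
  obtain ⟨x, hx⟩ : ∃ x, e i = x + 1 := ⟨e i - 1, by omega⟩
  rw [hx, Nat.add_sub_cancel]
  ring

/-- If `𝔞` has grade at least two on `R ⧸ ⟨f i : i ∈ P⟩` for all small `P ⊂ C`, then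
`starSpan f h T D C` is saturated with respect to `𝔞`. -/
theorem IsHGeneric.mem_starSpan_of_forall_mul_mem (hf : IsHGeneric f h) (hh : 0 < h)
    (hC : C.Nonempty) (𝔞 : Ideal R)
    (hP : ∀ P ⊂ C, P.card < h → ∃ g₁ ∈ 𝔞, ∃ g₂ ∈ 𝔞, NzdMod (Ideal.span (f '' P)) g₁ ∧
      NzdMod (Ideal.span (f '' P) ⊔ Ideal.span {g₁}) g₂)
    {z : R} (hz : ∀ r ∈ 𝔞, r * z ∈ starSpan f h T D C) : z ∈ starSpan f h T D C := by
  rw [starSpan_eq_span_starBox] at hz ⊢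
  refine mem_span_of_linearQuotients _ (starKey C) 𝔞 ?_ (starBox h T D C) ?_ z hz
  · obtain ⟨g, hg, -, -, hn, -⟩ := hP ∅ (Finset.empty_ssubset.2 hC) (by simpa using hh)
    refine ⟨g, hg, ?_⟩
    simpa using hn
  intro e he L' hL' hlow hhigh
  obtain ⟨heT, he0, heS⟩ := mem_starBox.1 he
  by_cases hmin : ∀ i ∈ C, 0 < e i → Function.update e i (e i - 1) ∉ starExp h T D C
  · right
    obtain ⟨P, hPC, hPh, hmove, hsep⟩ := exists_linearQuotient_indices hh hC heS hmin
    refine ⟨Ideal.span (f '' P), fun c => ⟨fun hc => ?_, fun hc => ?_⟩, hP P hPC hPh⟩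
    · refine hf.mem_span_of_mul_prod_mem hPC.subset hPh.le (fun v hv => ?_) hc
      have hvL := hL' hv
      rw [Finset.mem_erase] at hvL
      obtain ⟨-, hv0, hvS⟩ := mem_starBox.1 hvL.2
      refine hsep v hvS ?_ (hhigh v hv)
      by_contra! hcon
      refine hvL.1 (funext fun i => ?_)
      by_cases hi : i ∈ C
      · exact hcon i hi
      · rw [hv0 i hi, he0 i hi]
    · induction hc using Submodule.span_induction with
      | zero => simp
      | add x y _ _ hx hy => rw [add_mul]; exact add_mem hx hy
      | smul r x _ hx => rw [smul_eq_mul, mul_assoc]; exact Ideal.mul_mem_left _ _ hx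
      | mem x hx =>
        obtain ⟨j, hj, rfl⟩ := hx
        obtain ⟨i, hi, hlt, hkey⟩ := hmove j hj
        have hjC := hPC.subset hj
        have hij : i ≠ j := by rintro rfl; exact lt_irrefl _ hlt
        rw [← mul_prod_moveUnit f e hi hjC hij (by omega)]
        refine Ideal.mul_mem_left _ _ (Ideal.subset_span ⟨_, hlow _ (mem_starBox.2
          ⟨fun k hk => ?_, fun k hk => ?_, moveUnit_mem_starExp heS hjC hlt⟩) hkey, rfl⟩)
        · have hi' := heT i hi
          by_cases hkj : k = j
          · rw [hkj, moveUnit_target]; omega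
          · by_cases hki : k = i
            · rw [hki, moveUnit_source e hij]; omega
            · rw [moveUnit_of_ne e hki hkj]; exact heT k hk
        · rw [moveUnit_of_ne e (ne_of_mem_of_not_mem hi hk).symm
            (ne_of_mem_of_not_mem hjC hk).symm]
          exact he0 k hk
  · left
    push Not at hmin
    obtain ⟨i, hi, hpos, hmem⟩ := hmin
    refine Ideal.mem_of_dvd _ (Finset.prod_dvd_prod_of_dvd _ _ fun k _ => pow_dvd_pow (f k) ?_)
      (Ideal.subset_span ⟨Function.update e i (e i - 1), hlow _ (mem_starBox.2
        ⟨fun k hk => ?_, fun k hk => ?_, hmem⟩) (starKey_update_lt hi hpos), rfl⟩)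
    · by_cases hki : k = i
      · subst hki; rw [Function.update_self]; omega
      · rw [Function.update_of_ne hki]
    · by_cases hki : k = i
      · subst hki; rw [Function.update_self]; have := heT k hk; omega
      · rw [Function.update_of_ne hki]; exact heT k hk
    · rw [Function.update_of_ne (ne_of_mem_of_not_mem hi hk).symm]
      exact he0 k hk

end StarSpan

theorem exists_le_sum_eq {ι : Type*} [DecidableEq ι] (A : Finset ι) (u : ι → ℕ) {n : ℕ}
    (hn : n ≤ ∑ i ∈ A, u i) : ∃ u' : ι → ℕ, (∀ i, u' i ≤ u i) ∧ ∑ i ∈ A, u' i = n := by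
  induction A using Finset.induction_on generalizing n with
  | empty => exact ⟨0, fun _ => Nat.zero_le _, by simp at hn ⊢; omega⟩
  | insert j A hj ih =>
    rw [Finset.sum_insert hj] at hn
    obtain ⟨u', hle, hsum⟩ := ih (n := n - min (u j) n) (by omega)
    refine ⟨Function.update u' j (min (u j) n), fun i => ?_, ?_⟩
    · by_cases hij : i = j
      · subst hij; rw [Function.update_self]; omega
      · rw [Function.update_of_ne hij]; exact hle i
    · rw [Finset.sum_insert hj, Function.update_self, Finset.sum_congr rfl fun i hi =>
        Function.update_of_ne (ne_of_mem_of_not_mem hi hj) _ _, hsum]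
      omega

theorem exists_between_sum_eq {ι : Type*} [DecidableEq ι] (A : Finset ι) {l r : ι → ℕ}
    (hlr : ∀ i, l i ≤ r i) {n : ℕ} (hl : ∑ i ∈ A, l i ≤ n) (hr : n ≤ ∑ i ∈ A, r i) :
    ∃ u : ι → ℕ, (∀ i, l i ≤ u i) ∧ (∀ i, u i ≤ r i) ∧ ∑ i ∈ A, u i = n := by
  have h1 : ∑ i ∈ A, (r i - l i) + ∑ i ∈ A, l i = ∑ i ∈ A, r i := by
    rw [← Finset.sum_add_distrib]
    exact Finset.sum_congr rfl fun i _ => Nat.sub_add_cancel (hlr i)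
  obtain ⟨u, hu, hsum⟩ := exists_le_sum_eq A (fun i => r i - l i) (n := n - ∑ i ∈ A, l i)
    (by omega)
  refine ⟨fun i => l i + u i, fun i => Nat.le_add_right _ _, fun i => ?_, ?_⟩
  · have h2 : u i ≤ r i - l i := hu i
    have h3 := hlr i
    change l i + u i ≤ r i
    omega
  · rw [Finset.sum_add_distrib, hsum]
    omega

theorem le_mul_add_div {u m b : ℕ} (hu : u ≤ (m + 1) * b) : u ≤ m * b + u / (m + 1) := by
  have h1 := Nat.div_add_mod u (m + 1)
  have h2 : u % (m + 1) < m + 1 := Nat.mod_lt u (Nat.succ_pos m)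
  have h3 : u / (m + 1) ≤ b := Nat.div_le_of_le_mul hu
  rcases h3.lt_or_eq with h4 | h4
  · have h5 : m * (u / (m + 1) + 1) ≤ m * b := Nat.mul_le_mul_left m h4
    have h6 : (m + 1) * (u / (m + 1)) = m * (u / (m + 1)) + u / (m + 1) := Nat.succ_mul _ _
    rw [Nat.mul_succ] at h5
    omega
  · rw [h4]
    exact hu.trans (Nat.succ_mul m b).le

section PowersAndProducts

variable {R : Type*} [CommRing R] {s h T D : ℕ} {f : Fin s → R} {C : Finset (Fin s)}

theorem starSpan_mul_le (f : Fin s → R) (h T D T' D' : ℕ) (C : Finset (Fin s)) :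
    starSpan f h T D C * starSpan f h T' D' C ≤ starSpan f h (T + T') (D + D') C := by
  rw [starSpan, starSpan, Ideal.span_mul_span, Ideal.span_le]
  rintro _ ⟨_, ⟨e, he, rfl⟩, _, ⟨e', he', rfl⟩, rfl⟩
  refine Ideal.subset_span ⟨e + e', starExp_add he he', ?_⟩
  simp only [Pi.add_apply, pow_add, Finset.prod_mul_distrib]

theorem starSpan_eq_top (f : Fin s → R) (h0 : (0 : Fin s → ℕ) ∈ starExp h T D C) :
    starSpan f h T D C = ⊤ :=
  (Ideal.eq_top_iff_one _).2 (Ideal.subset_span ⟨0, h0, by simp⟩)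

theorem starSpan_pow_le (f : Fin s → R) (h T D : ℕ) (C : Finset (Fin s)) (N : ℕ) :
    starSpan f h T D C ^ N ≤ starSpan f h (N * T) (N * D) C := by
  induction N with
  | zero =>
    rw [starSpan_eq_top f (T := 0 * T) fun B _ _ => by simp]
    exact le_top
  | succ N ih =>
    rw [pow_succ, Nat.succ_mul, Nat.succ_mul]
    exact (Ideal.mul_mono_left ih).trans (starSpan_mul_le f h _ _ _ _ C)

theorem sum_sub_le_of_mem_starExp {b : ℕ} (hh : 0 < h) {e : Fin s → ℕ}
    (he : e ∈ starExp h b (h - 1) Finset.univ) : ∑ i, (b - e i) ≤ h - 1 := by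
  have hcard : (Finset.univ.filter fun i => e i < b).card ≤ h := by
    by_contra! hcon
    obtain ⟨B, hB, hBh⟩ := Finset.exists_subset_card_eq hcon.le
    have h1 := he B (Finset.subset_univ B) hBh.le
    have h2 : B.card • 1 ≤ ∑ i ∈ B, (b - e i) := Finset.card_nsmul_le_sum _ _ _ fun i hi => by
      have := (Finset.mem_filter.1 (hB hi)).2
      omega
    rw [smul_eq_mul, mul_one] at h2
    omega
  refine le_trans (le_of_eq ?_) (he _ (Finset.subset_univ _) hcard)
  refine (Finset.sum_filter_of_ne fun i _ hi => ?_).symm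
  omega

/-- The `a`-fold product ideal in terms of defects. -/
theorem afoldIdeal_eq_starSpan (f : Fin s → R) {a b : ℕ} (hh : 0 < h) (hab : a + h = b * s + 1) :
    afoldIdeal f a b = starSpan f h b (h - 1) Finset.univ := by
  have hsum : ∀ e : Fin s → ℕ, (∀ i, e i ≤ b) → ∑ i, (b - e i) + ∑ i, e i = b * s := by
    intro e he
    rw [← Finset.sum_add_distrib, Finset.sum_congr rfl fun i _ => Nat.sub_add_cancel (he i)]
    simp [mul_comm]
  refine le_antisymm (Ideal.span_le.2 ?_) (Ideal.span_le.2 ?_)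
  · rintro _ ⟨e, heb, hea, rfl⟩
    refine Ideal.subset_span ⟨e, mem_starExp_of_sum_le ?_, rfl⟩
    have := hsum e heb
    omega
  · rintro _ ⟨e, he, rfl⟩
    have h1 := sum_sub_le_of_mem_starExp hh he
    have h2 := hsum (fun i => min (e i) b) fun i => min_le_right _ _
    have h3 : ∑ i, (b - min (e i) b) = ∑ i, (b - e i) :=
      Finset.sum_congr rfl fun i _ => by omega
    obtain ⟨e', hle, hsum'⟩ := exists_le_sum_eq Finset.univ (fun i => min (e i) b) (n := a)
      (by omega)
    exact Ideal.mem_of_dvd _ (Finset.prod_dvd_prod_of_dvd _ _ fun i _ =>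
        pow_dvd_pow _ ((hle i).trans (min_le_left _ _)))
      (Ideal.subset_span ⟨e', fun i => (hle i).trans (min_le_right _ _), hsum', rfl⟩)

theorem starSpan_univ_le {b : ℕ} (hh : 0 < h) (f : Fin s → R) (C : Finset (Fin s)) :
    starSpan f h b (h - 1) Finset.univ ≤ starSpan f h b (h - 1) C := by
  refine Ideal.span_le.2 ?_
  rintro _ ⟨e, he, rfl⟩
  exact Ideal.mem_of_dvd _ (Finset.prod_dvd_prod_of_subset _ _ _ (Finset.subset_univ C))
    (Ideal.subset_span ⟨e, mem_starExp_of_sum_le (sum_sub_le_of_mem_starExp hh he), rfl⟩)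

/-- A monomial of total defect at most `m * D` is a product of `m` monomials of defect at most
`D`. -/
theorem prod_mem_starSpan_pow {b m : ℕ} (f : Fin s → R) {g : Fin s → ℕ}
    (hg : ∑ i, (m * b - g i) ≤ m * D) :
    ∏ i, f i ^ g i ∈ starSpan f h b D Finset.univ ^ m := by
  induction m generalizing g with
  | zero => simp
  | succ m ih =>
    set u : Fin s → ℕ := fun i => (m + 1) * b - g i with hu
    have hub : ∀ i, u i ≤ (m + 1) * b := fun i => Nat.sub_le _ _
    obtain ⟨u', hlu, hur, hsum⟩ := exists_between_sum_eq Finset.univ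
      (l := fun i => u i / (m + 1)) (r := fun i => (u i + m) / (m + 1))
      (fun i => Nat.div_le_div_right (Nat.le_add_right _ _)) (n := (∑ i, u i) / (m + 1))
      (by
        rw [Nat.le_div_iff_mul_le (Nat.succ_pos m), Finset.sum_mul]
        exact Finset.sum_le_sum fun i _ => Nat.div_mul_le_self _ _)
      (by
        refine Nat.div_le_of_le_mul ?_
        rw [Finset.mul_sum]
        refine Finset.sum_le_sum fun i _ => ?_
        have h1 := Nat.div_add_mod (u i + m) (m + 1)
        have h2 : (u i + m) % (m + 1) < m + 1 := Nat.mod_lt _ (Nat.succ_pos m)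
        omega)
    have hu'b : ∀ i, u' i ≤ b := fun i => (hur i).trans <| by
      have h1 : (b + 1) * (m + 1) = (m + 1) * b + (m + 1) := by ring
      have h2 := hub i
      have h3 : (u i + m) / (m + 1) < b + 1 :=
        (Nat.div_lt_iff_lt_mul (show 0 < m + 1 by omega)).2 (by omega)
      exact Nat.lt_succ_iff.1 h3
    have hsucc : ∀ k, (m + 1) * k = m * k + k := fun k => Nat.succ_mul m k
    have hsb := hsucc b
    have hsD := hsucc D
    have hle : ∀ i, b - u' i ≤ g i ∧ m * b - (g i - (b - u' i)) ≤ u i - u' i ∧ u' i ≤ u i := by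
      intro i
      have h1 := le_mul_add_div (hub i)
      have h2 : u i / (m + 1) ≤ u' i := hlu i
      have h3 := hu'b i
      have h4 : u i = (m + 1) * b - g i := rfl
      have h5 : u' i ≤ u i := (hur i).trans <| by
        rcases Nat.eq_zero_or_pos (u i) with h0 | h0
        · rw [h0, zero_add, Nat.div_eq_of_lt (Nat.lt_succ_self m)]
        · refine Nat.div_le_of_le_mul ?_
          have := hsucc (u i)
          have := Nat.mul_le_mul_left m h0
          omega
      omega
    rw [Finset.prod_congr rfl fun i _ => show f i ^ g i =
      f i ^ (g i - (b - u' i)) * f i ^ (b - u' i) by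
        rw [← pow_add, Nat.sub_add_cancel (hle i).1], Finset.prod_mul_distrib, pow_succ]
    refine Ideal.mul_mem_mul (ih ?_) (Ideal.subset_span ⟨_, mem_starExp_of_sum_le ?_, rfl⟩)
    · have h1 := Finset.sum_le_sum fun i (_ : i ∈ Finset.univ) => (hle i).2.1
      have h2 : ∑ i, (u i - u' i) + ∑ i, u' i = ∑ i, u i := by
        rw [← Finset.sum_add_distrib]
        exact Finset.sum_congr rfl fun i _ => Nat.sub_add_cancel (hle i).2.2
      have h3 : ∑ i, u i ≤ m * D + (∑ i, u i) / (m + 1) := le_mul_add_div hg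
      omega
    · rw [Finset.sum_congr rfl fun i _ => Nat.sub_sub_self (hu'b i), hsum]
      exact Nat.div_le_of_le_mul hg

end PowersAndProducts

theorem prod_pow_mem_pow {R ι : Type*} [CommRing R] {𝔪 : Ideal R} {f : ι → R}
    (hf : ∀ i, f i ∈ 𝔪) (A : Finset ι) (e : ι → ℕ) {n : ℕ} (hn : n ≤ ∑ i ∈ A, e i) :
    ∏ i ∈ A, f i ^ e i ∈ 𝔪 ^ n := by
  refine Ideal.pow_le_pow_right hn ?_
  rw [← Finset.prod_pow_eq_pow_sum]
  exact Ideal.prod_mem_prod fun i _ => Ideal.pow_mem_pow (hf i) _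

theorem exists_minimal_mem_starExp {ι : Type*} [DecidableEq ι] [Fintype ι] {h T D : ℕ}
    {C : Finset ι} {g : ι → ℕ} (hg : g ∈ starExp h T D C) :
    ∃ g' ∈ starExp h T D C, (∀ i, g' i ≤ g i) ∧
      ∀ i, 0 < g' i → Function.update g' i (g' i - 1) ∉ starExp h T D C := by
  induction hN : ∑ i, g i using Nat.strong_induction_on generalizing g with
  | _ N IH =>
  by_cases hmin : ∀ i, 0 < g i → Function.update g i (g i - 1) ∉ starExp h T D C
  · exact ⟨g, hg, fun _ => le_rfl, hmin⟩
  push Not at hmin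
  obtain ⟨i, hpos, hmem⟩ := hmin
  have h1 := sum_update_add (fun _ x => x) g (Finset.mem_univ i) (g i - 1)
  obtain ⟨g', hg', hle, hmin'⟩ := IH _ (by omega) hmem rfl
  refine ⟨g', hg', fun k => (hle k).trans ?_, hmin'⟩
  by_cases hki : k = i
  · subst hki; rw [Function.update_self]; omega
  · rw [Function.update_of_ne hki]

/-- A minimal exponent vector attains the maximal total defect on some `c + 1` indices. -/
theorem exists_sum_add_le_of_minimal {ι : Type*} [DecidableEq ι] [Fintype ι] {c T D : ℕ}
    (hcard : c + 1 ≤ Fintype.card ι) (hD : D ≤ T * (c + 1)) {g : ι → ℕ}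
    (hmin : ∀ i, 0 < g i →
      Function.update g i (g i - 1) ∉ starExp (c + 1) T D (Finset.univ : Finset ι))
    (hg : g ∈ starExp (c + 1) T D (Finset.univ : Finset ι)) :
    ∃ B : Finset ι, B.card = c + 1 ∧ ∑ i ∈ B, g i + D ≤ T * (c + 1) := by
  have hgT : ∀ i, g i ≤ T := by
    intro i
    by_contra! hlt
    refine hmin i (by omega) fun B hB hc => (Finset.sum_le_sum fun k _ => ?_).trans (hg B hB hc)
    by_cases hki : k = i
    · subst hki; rw [Function.update_self]; omega
    · rw [Function.update_of_ne hki]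
  by_cases h0 : ∀ i, g i = 0
  · obtain ⟨B, -, hB⟩ := Finset.exists_subset_card_eq (s := (Finset.univ : Finset ι)) hcard
    exact ⟨B, hB, by simpa [h0] using hD⟩
  push Not at h0
  obtain ⟨i, hi⟩ := h0
  have hnot := hmin i (Nat.pos_of_ne_zero hi)
  simp only [starExp, Set.mem_ofPred_eq, not_forall, not_le] at hnot
  obtain ⟨B₀, -, hB₀, hlt⟩ := hnot
  obtain ⟨B, hBB, hB⟩ := Finset.exists_superset_card_eq hB₀ hcard
  have h1 := hlt.trans_le (Finset.sum_le_sum_of_subset hBB)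
  have h2 : ∑ k ∈ B, (T - g k) + ∑ k ∈ B, g k = T * (c + 1) := by
    rw [← Finset.sum_add_distrib, Finset.sum_congr rfl fun k _ => Nat.sub_add_cancel (hgT k)]
    simp [hB, mul_comm]
  refine ⟨B, hB, ?_⟩
  have hiB : i ∈ B := by
    by_contra hiB
    rw [Finset.sum_congr rfl fun k hk => congrArg (T - ·)
      (Function.update_of_ne (ne_of_mem_of_not_mem hk hiB) _ _)] at h1
    have := hg B (Finset.subset_univ B) hB.le
    omega
  have h3 := sum_update_add (fun _ x => T - x) g hiB (g i - 1)
  omega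

theorem div_mem_starExp {ι : Type*} {b c l m : ℕ} (hl : 0 < l) {e : ι → ℕ} {C : Finset ι}
    (he : e ∈ starExp (c + 1) (l * (c + m) * b) (l * (c + m) * c) C) :
    (fun i => e i / l) ∈ starExp (c + 1) (m * b) (m * c) C := by
  intro B hB hc
  set A := B.filter fun i => e i / l < m * b with hA
  have hAB : A ⊆ B := Finset.filter_subset _ _
  have hAsum : ∑ i ∈ A, (m * b - e i / l) = ∑ i ∈ B, (m * b - e i / l) :=
    Finset.sum_filter_of_ne fun i _ hi => by omega
  have hAcard : A.card ≤ c + 1 := (Finset.card_le_card hAB).trans hc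
  rw [← hAsum]
  rcases le_or_gt (b * A.card) c with hp | hp
  · calc ∑ i ∈ A, (m * b - e i / l) ≤ A.card • (m * b) :=
          Finset.sum_le_card_nsmul _ _ _ fun i _ => Nat.sub_le _ _
      _ = m * (b * A.card) := by rw [smul_eq_mul]; ring
      _ ≤ m * c := Nat.mul_le_mul_left m hp
  have h1 := he A (hAB.trans hB) hAcard
  have h2 : ∑ i ∈ A, (l * c * b + l * (m * b - e i / l)) ≤
      ∑ i ∈ A, ((l * (c + m) * b - e i) + (l - 1)) := by
    refine Finset.sum_le_sum fun i hi => ?_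
    have hlt := (Finset.mem_filter.1 hi).2
    have h3 := Nat.div_add_mod (e i) l
    have h4 := Nat.mod_lt (e i) hl
    obtain ⟨d, hd⟩ : ∃ d, m * b = e i / l + d := ⟨_, (Nat.add_sub_cancel' hlt.le).symm⟩
    have h5 : l * (c + m) * b = l * c * b + (l * (e i / l) + l * d) := by
      rw [← mul_add, ← hd]; ring
    rw [hd, Nat.add_sub_cancel_left]
    omega
  rw [Finset.sum_add_distrib, Finset.sum_add_distrib, Finset.sum_const, Finset.sum_const,
    smul_eq_mul, smul_eq_mul, ← Finset.mul_sum] at h2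
  have h6 : l * c * (c + 1) ≤ A.card * (l * c * b) := by
    calc l * c * (c + 1) ≤ l * c * (b * A.card) := Nat.mul_le_mul_left _ hp
      _ = A.card * (l * c * b) := by ring
  have h7 : A.card * (l - 1) ≤ (c + 1) * (l - 1) := Nat.mul_le_mul_right _ hAcard
  obtain ⟨l, rfl⟩ : ∃ k, l = k + 1 := ⟨l - 1, by omega⟩
  rw [Nat.add_sub_cancel] at *
  by_contra! hcon
  have h8 : (l + 1) * (m * c + 1) ≤ (l + 1) * ∑ i ∈ A, (m * b - e i / (l + 1)) :=
    Nat.mul_le_mul_left _ hcon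
  nlinarith

theorem starSpan_le_mul_pow {R : Type*} [CommRing R] {s b c l m : ℕ} {f : Fin s → R}
    {𝔪 : Ideal R} (hf : ∀ i, f i ∈ 𝔪) (hb : 0 < b) (hl : 0 < l) (hs : c + 1 ≤ s) :
    starSpan f (c + 1) (l * (c + m) * b) (l * (c + m) * c) Finset.univ ≤
      𝔪 ^ (l * c) * starSpan f (c + 1) (m * b) (m * c) Finset.univ ^ l := by
  refine Ideal.span_le.2 ?_
  rintro _ ⟨e, he, rfl⟩
  obtain ⟨g, hg, hle, hmin⟩ := exists_minimal_mem_starExp (div_mem_starExp hl he)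
  have hbc : c + 1 ≤ b * (c + 1) := Nat.le_mul_of_pos_left _ hb
  obtain ⟨B, hB, hsum⟩ := exists_sum_add_le_of_minimal (by simpa using hs)
    (by rw [mul_assoc]; exact Nat.mul_le_mul_left _ (by omega)) hmin hg
  have hge : ∀ i, l * g i ≤ e i := fun i => (Nat.mul_le_mul_left l (hle i)).trans
    (Nat.mul_div_le _ _)
  have h1 := he B (Finset.subset_univ B) hB.le
  have h2 : l * (c + m) * b * (c + 1) ≤
      ∑ i ∈ B, (l * (c + m) * b - e i) + ∑ i ∈ B, e i := by
    rw [← Finset.sum_add_distrib]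
    calc l * (c + m) * b * (c + 1) = ∑ i ∈ B, l * (c + m) * b := by simp [hB, mul_comm]
      _ ≤ _ := Finset.sum_le_sum fun i _ => by omega
  have h3 : ∑ i ∈ B, (e i - l * g i) + l * ∑ i ∈ B, g i = ∑ i ∈ B, e i := by
    rw [Finset.mul_sum, ← Finset.sum_add_distrib]
    exact Finset.sum_congr rfl fun i _ => Nat.sub_add_cancel (hge i)
  have h4 : l * c ≤ ∑ i, (e i - l * g i) := by
    refine le_trans ?_ (Finset.sum_le_sum_of_subset (Finset.subset_univ B))
    have h5 : l * (∑ i ∈ B, g i + m * c) ≤ l * (m * b * (c + 1)) := Nat.mul_le_mul_left l hsum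
    have h6 : l * c * (c + 1) ≤ l * c * (b * (c + 1)) := Nat.mul_le_mul_left _ hbc
    nlinarith
  have h7 : ∏ i, f i ^ e i = (∏ i, f i ^ (e i - l * g i)) * (∏ i, f i ^ g i) ^ l := by
    rw [← Finset.prod_pow, ← Finset.prod_mul_distrib]
    refine Finset.prod_congr rfl fun i _ => ?_
    rw [← pow_mul, ← pow_add, mul_comm (g i) l, Nat.sub_add_cancel (hge i)]
  simp only [h7]
  have h8 : ∏ i, f i ^ g i ∈ starSpan f (c + 1) (m * b) (m * c) Finset.univ :=
    Ideal.subset_span ⟨g, hg, rfl⟩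
  exact Ideal.mul_mem_mul (prod_pow_mem_pow hf _ _ h4) (Ideal.pow_mem_pow h8 l)

section Symbolic

variable {R : Type*} [CommRing R] {s h b : ℕ} {f : Fin s → R}

/-- The ideals `⟨f i : i ∈ C⟩` with `h / b ≤ #C ≤ h` are colon ideals of the star configuration
ideal. -/
theorem IsHGeneric.exists_colon_eq (hf : IsHGeneric f h) (hh : 0 < h) (hb : 0 < b)
    {C : Finset (Fin s)} (hC : C.card ≤ h) (hbC : h ≤ b * C.card) :
    ∃ μ, ∀ r, r * μ ∈ starSpan f h b (h - 1) Finset.univ ↔ r ∈ Ideal.span (f '' C) := by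
  obtain ⟨w, hw1, hwb, hw⟩ := exists_between_sum_eq C (l := fun _ => 1) (r := fun _ => b)
    (fun _ => hb) (n := h) (by simpa using hC) (by simpa [mul_comm] using hbC)
  set u : Fin s → ℕ := fun i => if i ∈ C then b - w i else b with hu
  have hsum : ∑ i, (b - u i) = h := by
    rw [← hw, ← Finset.univ_inter C, ← Finset.sum_ite_mem]
    refine Finset.sum_congr rfl fun i _ => ?_
    have := hwb i
    by_cases hi : i ∈ C
    · simp only [hu, if_pos hi]; omega
    · simp only [hu, if_neg hi]; omega
  refine ⟨∏ i, f i ^ u i, fun r => ⟨fun hr => ?_, fun hr => ?_⟩⟩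
  · refine hf.mem_span_of_mul_prod_mem (Finset.subset_univ C) hC (fun v hv => ?_) hr
    by_contra! hcon
    have h1 := hv C (Finset.subset_univ C) hC
    have h2 : ∑ i ∈ C, w i ≤ ∑ i ∈ C, (b - v i) := Finset.sum_le_sum fun i hi => by
      have h3 := hcon i hi
      have h4 := hwb i
      simp only [hu, if_pos hi] at h3
      omega
    omega
  · have hle : Ideal.span (f '' C) * Ideal.span {∏ i, f i ^ u i} ≤
        starSpan f h b (h - 1) Finset.univ := by
      rw [Ideal.span_mul_span, Ideal.span_le]
      rintro _ ⟨_, ⟨i, hi, rfl⟩, _, rfl, rfl⟩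
      have hui : u i < b := by
        have h1 : 1 ≤ w i := hw1 i
        simp only [hu, if_pos (Finset.mem_coe.1 hi)]
        omega
      refine Ideal.subset_span ⟨Function.update u i (u i + 1), mem_starExp_of_sum_le ?_, ?_⟩
      · have := sum_update_add (fun _ x => b - x) u (Finset.mem_univ i) (u i + 1)
        omega
      · beta_reduce
        rw [← Finset.mul_prod_erase Finset.univ _ (Finset.mem_univ i), Function.update_self,
          ← Finset.mul_prod_erase Finset.univ (fun i => f i ^ u i) (Finset.mem_univ i), pow_succ',
          mul_assoc]
        congr 2
        exact Finset.prod_congr rfl fun k hk => by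
          rw [Function.update_of_ne (Finset.ne_of_mem_erase hk)]
    exact hle (Ideal.mul_mem_mul hr (Ideal.mem_span_singleton_self _))

theorem pow_mul_mem_starSpan {T D : ℕ} {C : Finset (Fin s)} {j : Fin s} (hj : j ∈ C) {x : R}
    (hx : x ∈ starSpan f h T D (C.erase j)) : f j ^ T * x ∈ starSpan f h T D C := by
  have hle : Ideal.span {f j ^ T} * starSpan f h T D (C.erase j) ≤ starSpan f h T D C := by
    rw [starSpan, Ideal.span_mul_span, Ideal.span_le]
    rintro _ ⟨_, rfl, _, ⟨e, he, rfl⟩, rfl⟩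
    refine Ideal.subset_span ⟨Function.update e j T, fun B hB hc => ?_, ?_⟩
    · have h1 : ∑ i ∈ B.erase j, (T - Function.update e j T i) =
          ∑ i ∈ B, (T - Function.update e j T i) :=
        Finset.sum_erase _ (by simp)
      rw [← h1, Finset.sum_congr rfl fun k hk => congrArg (T - ·)
        (Function.update_of_ne (Finset.ne_of_mem_erase hk) _ _)]
      exact he _ (Finset.erase_subset_erase j hB)
        ((Finset.card_le_card (Finset.erase_subset j B)).trans hc)
    · beta_reduce
      rw [← Finset.mul_prod_erase C _ hj, Function.update_self]
      congr 1
      exact Finset.prod_congr rfl fun k hk => by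
        rw [Function.update_of_ne (Finset.ne_of_mem_erase hk)]
  exact hle (Ideal.mul_mem_mul (Ideal.mem_span_singleton_self _) hx)

theorem exists_notMem_mul_mem_of_mem_symbolicPower {I : Ideal R} {N : ℕ} {x : R}
    (hx : x ∈ symbolicPower I N) {q : Ideal R} (hq : q ∈ associatedPrimes R (R ⧸ I)) :
    ∃ t ∉ q, t * x ∈ I ^ N := by
  have : q.IsPrime := hq.isPrime
  simp only [symbolicPower, Ideal.mem_iInf] at hx
  have := hx q hq
  rw [Ideal.mem_comap, IsLocalization.algebraMap_mem_map_algebraMap_iff q.primeCompl] at this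
  obtain ⟨t, ht, htx⟩ := this
  exact ⟨t, ht, htx⟩

/-- Upper bound for the symbolic powers, by induction on `C`. -/
theorem IsHGeneric.symbolicPower_le_starSpan [IsNoetherianRing R] (hf : IsHGeneric f h)
    (hh : 0 < h) (hb : 0 < b) (N : ℕ) (C : Finset (Fin s)) :
    symbolicPower (starSpan f h b (h - 1) Finset.univ) N ≤
      starSpan f h (N * b) (N * (h - 1)) C := by
  intro x hx
  induction C using Finset.strongInduction with
  | H C IH =>
  by_cases hsmall : C.card ≤ h ∧ b * C.card < h
  · rw [starSpan_eq_top]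
    · exact Submodule.mem_top
    · intro B hB _
      calc ∑ i ∈ B, (N * b - (0 : Fin s → ℕ) i) = N * (b * B.card) := by simp; ring
        _ ≤ N * (h - 1) := by
          refine Nat.mul_le_mul_left N ?_
          have := Nat.mul_le_mul_left b (Finset.card_le_card hB)
          omega
  have hCne : C.Nonempty := by
    rw [Finset.nonempty_iff_ne_empty]
    rintro rfl
    exact hsmall (by simpa using hh)
  let 𝔞 : Ideal R := Submodule.comap (LinearMap.toSpanSingleton R R x)
    (starSpan f h (N * b) (N * (h - 1)) C)
  have hpow : ∀ j ∈ C, f j ^ (N * b) ∈ 𝔞 := fun j hj =>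
    pow_mul_mem_starSpan hj (IH _ (Finset.erase_ssubset hj))
  refine hf.mem_starSpan_of_forall_mul_mem hh hCne 𝔞 (fun P hPC hPh => ?_) fun r hr => hr
  obtain ⟨j, hjC, hjP⟩ := Finset.exists_of_ssubset hPC
  have hgj := (hf P j hPh.le hjP).pow (N * b)
  by_cases hk : ∃ k ∈ C, k ∉ P ∧ j ≠ k
  · obtain ⟨k, hkC, hkP, hjk⟩ := hk
    exact ⟨_, hpow j hjC, _, hpow k hkC, hgj, hf.nzdMod_sup_pow hPh hjP hkP hjk _ _⟩
  push Not at hk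
  have hCP : C = insert j P := by
    refine Finset.Subset.antisymm (fun k hkC => ?_) (Finset.insert_subset hjC hPC.subset)
    by_cases hkP : k ∈ P
    · exact Finset.mem_insert_of_mem hkP
    · exact Finset.mem_insert.2 (Or.inl (hk k hkC hkP).symm)
  have hCcard : C.card ≤ h := by
    rw [hCP, Finset.card_insert_of_notMem hjP]
    exact hPh
  obtain ⟨μ, hμ⟩ := hf.exists_colon_eq hh hb hCcard (by
    by_contra! hlt
    exact hsmall ⟨hCcard, hlt⟩)
  obtain ⟨t, ht, htC⟩ := exists_nzdMod_of_not_le_associatedPrimes (J := Ideal.span (f '' C))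
    (c := 𝔞) fun q hq hle => by
      obtain ⟨t, htq, htx⟩ := exists_notMem_mul_mem_of_mem_symbolicPower hx
        (associatedPrimes_quotient_colon_subset hμ hq)
      exact htq (hle ((Ideal.pow_right_mono (starSpan_univ_le hh f C) N).trans
        (starSpan_pow_le f h b (h - 1) C N) htx))
  refine ⟨_, hpow j hjC, t, ht, hgj, (hf P j hPh.le hjP).sup_span_pow ?_ _⟩
  rwa [hCP, Finset.coe_insert, Set.image_insert_eq, Ideal.span_insert, sup_comm] at htC

theorem IsHGeneric.card_filter_mem_le [IsNoetherianRing R] (hf : IsHGeneric f h) (hh : 0 < h)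
    {p : Ideal R} [DecidablePred fun i => f i ∈ p]
    (hp : p ∈ associatedPrimes R (R ⧸ starSpan f h b (h - 1) Finset.univ)) :
    (Finset.univ.filter fun i => f i ∈ p).card ≤ h := by
  obtain ⟨hprime, z, hz⟩ := mem_associatedPrimes_quotient_iff.1 hp
  by_contra! hcard
  obtain ⟨i, -⟩ := Finset.card_pos.1 (hh.trans hcard)
  have hzI := hf.mem_starSpan_of_forall_mul_mem (T := b) (D := h - 1) hh
    (C := Finset.univ) ⟨i, Finset.mem_univ i⟩ p (fun P _ hPh => ?_) fun r hr => (hz r).1 hr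
  · exact hprime.ne_top ((Ideal.eq_top_iff_one p).2 ((hz 1).2 (by rwa [one_mul])))
  · have h1 := Finset.le_card_sdiff P (Finset.univ.filter fun i => f i ∈ p)
    obtain ⟨j, hj, k, hk, hjk⟩ := Finset.one_lt_card.1
      (show 1 < ((Finset.univ.filter fun i => f i ∈ p) \ P).card by omega)
    rw [Finset.mem_sdiff, Finset.mem_filter] at hj hk
    have h2 := hf.nzdMod_sup_pow hPh hj.2 hk.2 hjk 1 1
    rw [pow_one, pow_one] at h2
    exact ⟨_, hj.1.2, _, hk.1.2, hf P j hPh.le hj.2, h2⟩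

/-- Lower bound for the symbolic powers, by splitting exponent vectors locally at each associated
prime. -/
theorem IsHGeneric.starSpan_le_symbolicPower [IsNoetherianRing R] (hf : IsHGeneric f h)
    (hh : 0 < h) (m : ℕ) :
    starSpan f h (m * b) (m * (h - 1)) Finset.univ ≤
      symbolicPower (starSpan f h b (h - 1) Finset.univ) m := by
  classical
  refine le_iInf₂ fun p hp => Ideal.span_le.2 ?_
  rintro _ ⟨e, he, rfl⟩
  have : p.IsPrime := hp.isPrime
  rw [SetLike.mem_coe, Ideal.mem_comap,
    IsLocalization.algebraMap_mem_map_algebraMap_iff p.primeCompl]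
  refine ⟨∏ i, f i ^ (if f i ∈ p then 0 else m * b), fun hmem => ?_, ?_⟩
  · obtain ⟨i, -, hi⟩ := (Ideal.IsPrime.prod_mem_iff (hp := hp.isPrime)).1 hmem
    split_ifs at hi with hip
    · rw [pow_zero] at hi
      exact hp.isPrime.ne_top ((Ideal.eq_top_iff_one p).2 hi)
    · exact hip (hp.isPrime.mem_of_pow_mem _ hi)
  · rw [← Finset.prod_mul_distrib, Finset.prod_congr rfl fun i _ => (pow_add _ _ _).symm]
    refine prod_mem_starSpan_pow f (le_trans ?_ (he _ (Finset.subset_univ _)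
      (hf.card_filter_mem_le hh hp)))
    rw [Finset.sum_filter]
    refine Finset.sum_le_sum fun i _ => ?_
    split_ifs <;> omega

end Symbolic

theorem isHGeneric_of_isRegular {R ι : Type*} [CommRing R] [DecidableEq ι] {f : ι → R} {h : ℕ}
    (hf : ∀ l : List ι, l.Nodup → l.length ≤ h + 1 → RingTheory.Sequence.IsRegular R (l.map f)) :
    IsHGeneric f h := by
  intro A j hA hj
  have hreg := (hf (A.toList ++ [j]) (List.nodup_append.2 ⟨A.nodup_toList, List.nodup_singleton j,
    fun a ha b hb => by
      rw [List.mem_singleton] at hb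
      rw [hb]
      exact ne_of_mem_of_not_mem (Finset.mem_toList.1 ha) hj⟩)
    (by simpa using hA)).toIsWeaklyRegular.regular_mod_prev A.card (by simp)
  have hspan : Ideal.ofList (((A.toList ++ [j]).map f).take A.card) = Ideal.span (f '' A) := by
    rw [List.map_append, List.take_left' (by simp)]
    exact congrArg Ideal.span (by ext; simp)
  rw [hspan, smul_eq_mul, Ideal.mul_top, isSMulRegular_quotient_iff_mem_of_smul_mem] at hreg
  intro x hx
  exact hreg x (by simpa using hx)

theorem MvPolynomial.IsHomogeneous.mem_span_range_X {σ K : Type*} [CommSemiring K]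
    {p : MvPolynomial σ K} {d : ℕ} (hp : p.IsHomogeneous d) (hd : 0 < d) :
    p ∈ Ideal.span (Set.range (X : σ → MvPolynomial σ K)) := by
  rw [← Set.image_univ, mem_ideal_span_X_image]
  intro e he
  by_contra! hcon
  have he0 : e = 0 := Finsupp.ext fun i => hcon i (Set.mem_univ i)
  have := hp (mem_support_iff.1 he)
  rw [he0, map_zero] at this
  omega

/-- The Harbourne–Huneke containment
`I^{(ℓ(h+m-1))} ⊆ 𝔪^{ℓ(h-1)} (I^{(m)})^ℓ` holds for the generalized star configuration
ideal `I = I_a(F^b)` of an `h`-generic set of `s` forms of degree `d`. -/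
theorem genStarConfig_harbourneHuneke {K : Type*} [Field K] [Infinite K]
    (n s a b d : ℕ) (hs : 0 < s) (ha : 0 < a) (hb0 : 0 < b) (hd : 0 < d)
    (ha1 : (b - 1) * s + 1 < a) (ha2 : a ≤ b * s)
    (h : ℕ) (hh : h = b * s - a + 1) (hn : h ≤ n)
    (f : Fin s → MvPolynomial (Fin (n + 1)) K)
    (hinj : Function.Injective f) (hne : ∀ i, f i ≠ 0)
    (hhom : ∀ i, (f i).IsHomogeneous d)
    (hgen : ∀ l : List (Fin s), l.Nodup → l.length ≤ h + 1 →
      RingTheory.Sequence.IsRegular (MvPolynomial (Fin (n + 1)) K) (l.map f))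
    (l m : ℕ) (hl : 0 < l) (hm : 0 < m) :
    symbolicPower (afoldIdeal f a b) (l * (h + m - 1)) ≤
      (Ideal.span (Set.range (X : Fin (n + 1) → MvPolynomial (Fin (n + 1)) K))) ^ (l * (h - 1)) *
        (symbolicPower (afoldIdeal f a b) m) ^ l := by
  obtain ⟨c, rfl⟩ : ∃ c, h = c + 1 := ⟨h - 1, by omega⟩
  have hbs : (b - 1) * s + s = b * s := by
    rw [← Nat.succ_mul, Nat.succ_eq_add_one, Nat.sub_add_cancel hb0]
  have hf := isHGeneric_of_isRegular hgen
  have hI := afoldIdeal_eq_starSpan f (a := a) (b := b) (Nat.succ_pos c) (by omega)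
  rw [hI, show c + 1 + m - 1 = c + m by omega, Nat.add_sub_cancel]
  calc symbolicPower _ (l * (c + m))
      ≤ starSpan f (c + 1) (l * (c + m) * b) (l * (c + m) * c) Finset.univ :=
        hf.symbolicPower_le_starSpan (Nat.succ_pos c) hb0 _ _
    _ ≤ _ := starSpan_le_mul_pow (fun i => (hhom i).mem_span_range_X hd) hb0 hl (by omega)
    _ ≤ _ := Ideal.mul_mono_right
        (Ideal.pow_right_mono (hf.starSpan_le_symbolicPower (Nat.succ_pos c) m) l)
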